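/- Let ε ∈ (0, 3/4) and X ∈ St(p,n)^ε. Then for every G ∈ ℝ^{n×p}, ⟨(XᵀX − I_p)², sym(XᵀG)⟩ ≤ 4√(1+ε)·‖G‖_F·N(X), where N(X) := (1/4)‖XᵀX − I_p‖_F². -/

import Mathlib

open Matrix Finset

noncomputable section

/-- Frobenius inner product `⟨A, B⟩ = Tr (Aᵀ * B)`. -/
def finner {n p : ℕ} (A B : Matrix (Fin n) (Fin p) ℝ) : ℝ :=
  (Aᵀ * B).trace

/-- Frobenius norm `‖A‖_F = √(Tr (Aᵀ * A))`. -/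
def fnorm {n p : ℕ} (A : Matrix (Fin n) (Fin p) ℝ) : ℝ :=
  Real.sqrt ((Aᵀ * A).trace)

/-- Skew-symmetric part `skew M = (M - Mᵀ)/2`. -/
def skewPart {m : ℕ} (M : Matrix (Fin m) (Fin m) ℝ) : Matrix (Fin m) (Fin m) ℝ :=
  (1 / 2 : ℝ) • (M - Mᵀ)

/-- Symmetric part `sym M = (M + Mᵀ)/2`. -/
def symPart {m : ℕ} (M : Matrix (Fin m) (Fin m) ℝ) : Matrix (Fin m) (Fin m) ℝ :=
  (1 / 2 : ℝ) • (M + Mᵀ)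

/-- Penalty function `N(X) = ‖XᵀX - I‖_F² / 4`. -/
def penaltyN {n p : ℕ} (X : Matrix (Fin n) (Fin p) ℝ) : ℝ :=
  (1 / 4 : ℝ) * fnorm (Xᵀ * X - 1) ^ 2

/-- Landing direction `Λ̃(X; g) = skew(g Xᵀ) X + λ X (XᵀX - I)` with gradient estimate `g`. -/
def landingDir {n p : ℕ} (lam : ℝ) (X g : Matrix (Fin n) (Fin p) ℝ) :
    Matrix (Fin n) (Fin p) ℝ :=
  skewPart (g * Xᵀ) * X + lam • (X * (Xᵀ * X - 1))

theorem finner_eq_sum {n p : ℕ} (A B : Matrix (Fin n) (Fin p) ℝ) :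
    finner A B = ∑ x : Fin p × Fin n, A x.2 x.1 * B x.2 x.1 := by
  simp [finner, Matrix.trace, Matrix.mul_apply, Fintype.sum_prod_type]

theorem finner_self_nonneg {n p : ℕ} (A : Matrix (Fin n) (Fin p) ℝ) : 0 ≤ finner A A := by
  rw [finner_eq_sum]
  exact Finset.sum_nonneg fun _ _ => mul_self_nonneg _

theorem fnorm_sq {n p : ℕ} (A : Matrix (Fin n) (Fin p) ℝ) : fnorm A ^ 2 = finner A A :=
  Real.sq_sqrt (finner_self_nonneg A)

theorem fnorm_nonneg {n p : ℕ} (A : Matrix (Fin n) (Fin p) ℝ) : 0 ≤ fnorm A :=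
  Real.sqrt_nonneg _

/-- Cauchy–Schwarz for the Frobenius inner product. -/
theorem finner_le_fnorm_mul_fnorm {n p : ℕ} (A B : Matrix (Fin n) (Fin p) ℝ) :
    finner A B ≤ fnorm A * fnorm B := by
  refine le_of_sq_le_sq ?_ (mul_nonneg (fnorm_nonneg A) (fnorm_nonneg B))
  rw [mul_pow, fnorm_sq, fnorm_sq]
  simp only [finner_eq_sum, ← sq]
  exact Finset.sum_mul_sq_le_sq_mul_sq _ _ _

section
attribute [local instance] Matrix.frobeniusNormedAddCommGroup

theorem fnorm_eq_norm {n p : ℕ} (A : Matrix (Fin n) (Fin p) ℝ) : fnorm A = ‖A‖ := by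
  rw [Matrix.frobenius_norm_def, ← Real.sqrt_eq_rpow, Finset.sum_comm]
  simp [fnorm, Matrix.trace, Matrix.mul_apply, sq]

/-- The Frobenius norm is submultiplicative. -/
theorem fnorm_mul_le {l m n : ℕ} (A : Matrix (Fin l) (Fin m) ℝ) (B : Matrix (Fin m) (Fin n) ℝ) :
    fnorm (A * B) ≤ fnorm A * fnorm B := by
  simp only [fnorm_eq_norm]
  exact Matrix.frobenius_norm_mul A B

end

theorem finner_symPart {m : ℕ} {S : Matrix (Fin m) (Fin m) ℝ} (hS : Sᵀ = S)
    (M : Matrix (Fin m) (Fin m) ℝ) : finner S (symPart M) = finner S M := by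
  have h : (S * Mᵀ).trace = (S * M).trace := by
    rw [← Matrix.trace_transpose, Matrix.transpose_mul, Matrix.transpose_transpose, hS,
      Matrix.trace_mul_comm]
  simp only [finner, symPart, hS, Matrix.mul_smul, Matrix.mul_add, Matrix.trace_smul,
    Matrix.trace_add, h, smul_eq_mul]
  ring

/-- Left multiplication by `X` scales Frobenius norms by at most `√(1 + ‖XᵀX - I‖_F)`. -/
theorem fnorm_mul_sq_le {n p q : ℕ} (X : Matrix (Fin n) (Fin p) ℝ)
    (S : Matrix (Fin p) (Fin q) ℝ) :
    fnorm (X * S) ^ 2 ≤ (1 + fnorm (Xᵀ * X - 1)) * fnorm S ^ 2 := by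
  have h : fnorm (X * S) ^ 2 = fnorm S ^ 2 + finner S ((Xᵀ * X - 1) * S) := by
    simp only [fnorm_sq, finner, Matrix.transpose_mul, ← Matrix.trace_add]
    congr 1
    simp [Matrix.sub_mul, Matrix.mul_sub, Matrix.mul_assoc]
  have h₁ := finner_le_fnorm_mul_fnorm S ((Xᵀ * X - 1) * S)
  have h₂ := mul_le_mul_of_nonneg_left (fnorm_mul_le (Xᵀ * X - 1) S) (fnorm_nonneg S)
  linarith

/-- for `X` in the safe region and every `G`,
`⟨(XᵀX − I)², sym(XᵀG)⟩ ≤ 4√(1+ε) ‖G‖_F N(X)`. -/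
theorem penalty_sym_inner_bound {n p : ℕ} (ε : ℝ) (hε : ε ∈ Set.Ioo (0 : ℝ) (3 / 4))
    (X : Matrix (Fin n) (Fin p) ℝ) (hX : fnorm (Xᵀ * X - 1) ≤ ε) :
    ∀ G : Matrix (Fin n) (Fin p) ℝ,
      finner ((Xᵀ * X - 1) ^ 2) (symPart (Xᵀ * G)) ≤
        4 * Real.sqrt (1 + ε) * fnorm G * penaltyN X := by
  intro G
  set D := Xᵀ * X - 1 with hD
  have hDt : (D ^ 2)ᵀ = D ^ 2 := by
    simp [hD, Matrix.transpose_pow]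
  have hXD : fnorm (X * D ^ 2) ≤ Real.sqrt (1 + ε) * fnorm D ^ 2 := by
    have hD2 : fnorm (D ^ 2) ≤ fnorm D ^ 2 := by
      rw [sq, sq]
      exact fnorm_mul_le D D
    have hε0 : 0 ≤ 1 + ε := by linarith [hε.1]
    refine le_of_sq_le_sq ?_ (by positivity)
    rw [mul_pow, Real.sq_sqrt hε0]
    calc fnorm (X * D ^ 2) ^ 2 ≤ (1 + fnorm D) * fnorm (D ^ 2) ^ 2 := fnorm_mul_sq_le X _
      _ ≤ (1 + ε) * (fnorm D ^ 2) ^ 2 := by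
        have := fnorm_nonneg (D ^ 2)
        gcongr
  calc finner (D ^ 2) (symPart (Xᵀ * G)) = finner (X * D ^ 2) G := by
        rw [finner_symPart hDt, finner, finner, Matrix.transpose_mul, Matrix.mul_assoc]
    _ ≤ fnorm (X * D ^ 2) * fnorm G := finner_le_fnorm_mul_fnorm _ _
    _ ≤ Real.sqrt (1 + ε) * fnorm D ^ 2 * fnorm G :=
        mul_le_mul_of_nonneg_right hXD (fnorm_nonneg G)
    _ = 4 * Real.sqrt (1 + ε) * fnorm G * penaltyN X := by
        rw [penaltyN]
        ring
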